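/- Under the two-group random mixture model, let W_(1)≤…≤W_(n) be the order statistics of W1,…,Wn. For any τ∈(0,1) and n ≥ 1/τ: (a) for any integer k with τ ≤ k/n ≤ 1 and any ε>0, P(|(1/k)Σ_{i=1}^k W_(i) − a(k/n)| > ε) ≤ 6·exp(−nτ²ε²/2); (b) for any integer k with 0 ≤ k/n ≤ 1−τ and any ε>0, P(|(1/(n−k))Σ_{i=k+1}^n (1−W_(i)) − b(k/n)| > ε) ≤ 6·exp(−nτ²ε²/2). -/

import Mathlib

open MeasureTheory ProbabilityTheory Filter

namespace TwoGroup

/-- The two-group random mixture model: a σ-finite base measure on the sample space `𝒳`,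
a null proportion `π0 ∈ (0,1)`, and null/non-null probability density functions `f0`, `f1`
with respect to the base measure. -/
structure Model (𝒳 : Type*) [MeasurableSpace 𝒳] where
  base : Measure 𝒳
  sigmaFinite : SigmaFinite base
  π0 : ℝ
  π0_mem : π0 ∈ Set.Ioo (0 : ℝ) 1
  f0 : 𝒳 → ℝ
  f1 : 𝒳 → ℝ
  f0_meas : Measurable f0
  f1_meas : Measurable f1
  f0_nonneg : ∀ x, 0 ≤ f0 x
  f1_nonneg : ∀ x, 0 ≤ f1 x
  f0_prob : IsProbabilityMeasure (base.withDensity fun x => ENNReal.ofReal (f0 x))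
  f1_prob : IsProbabilityMeasure (base.withDensity fun x => ENNReal.ofReal (f1 x))

namespace Model

variable {𝒳 : Type*} [MeasurableSpace 𝒳] (M : Model 𝒳)

/-- The non-null proportion `π1 = 1 - π0`. -/
noncomputable def π1 : ℝ := 1 - M.π0

/-- The marginal density `f = π0 f0 + π1 f1`. -/
noncomputable def f (x : 𝒳) : ℝ := M.π0 * M.f0 x + M.π1 * M.f1 x

/-- The local false discovery rate `Lfdr(x) = π0 f0(x) / f(x)`. -/
noncomputable def Lfdr (x : 𝒳) : ℝ := M.π0 * M.f0 x / M.f x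

/-- The joint law of a single pair `(θ, X)`; `true` encodes `θ = 1` (non-null). -/
noncomputable def joint : Measure (Bool × 𝒳) :=
  (ENNReal.ofReal M.π0) •
      ((Measure.dirac false).prod (M.base.withDensity fun x => ENNReal.ofReal (M.f0 x))) +
    (ENNReal.ofReal M.π1) •
      ((Measure.dirac true).prod (M.base.withDensity fun x => ENNReal.ofReal (M.f1 x)))

/-- The joint law of `((θ1, X1), …, (θn, Xn))`: i.i.d. copies of `(θ, X)`. -/
noncomputable def jointN (n : ℕ) : Measure (Fin n → Bool × 𝒳) :=
  Measure.pi fun _ => M.joint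

end Model

/-- Number of rejections `Σ_i δ_i`. -/
def nRej {n : ℕ} (d : Fin n → Bool) : ℝ := ∑ i, if d i then (1 : ℝ) else 0

/-- Number of false discoveries `Σ_i δ_i (1 - θ_i)`. -/
def nFD {n : ℕ} (θ d : Fin n → Bool) : ℝ :=
  ∑ i, (if d i then (1 : ℝ) else 0) * (if θ i then (0 : ℝ) else 1)

/-- Number of acceptances `Σ_i (1 - δ_i)`. -/
def nAcc {n : ℕ} (d : Fin n → Bool) : ℝ := ∑ i, if d i then (0 : ℝ) else 1

/-- Number of false non-discoveries `Σ_i (1 - δ_i) θ_i`. -/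
def nFN {n : ℕ} (θ d : Fin n → Bool) : ℝ :=
  ∑ i, (if d i then (0 : ℝ) else 1) * (if θ i then (1 : ℝ) else 0)

/-- False discovery proportion. -/
noncomputable def FDP {n : ℕ} (θ d : Fin n → Bool) : ℝ := nFD θ d / max 1 (nRej d)

/-- False non-discovery proportion. -/
noncomputable def FNP {n : ℕ} (θ d : Fin n → Bool) : ℝ := nFN θ d / max 1 (nAcc d)

/-- A decision rule is a Markov kernel from `𝒳^n` to `{0,1}^n`: a measurable family of
probability measures on `Fin n → Bool`. -/
def IsRule {𝒳 : Type*} [MeasurableSpace 𝒳] {n : ℕ}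
    (κ : (Fin n → 𝒳) → Measure (Fin n → Bool)) : Prop :=
  Measurable κ ∧ ∀ x, IsProbabilityMeasure (κ x)

namespace Model

variable {𝒳 : Type*} [MeasurableSpace 𝒳] (M : Model 𝒳)

/-- The false discovery rate `FDR = E[FDP]` of a (randomized) decision rule. -/
noncomputable def FDR (n : ℕ) (κ : (Fin n → 𝒳) → Measure (Fin n → Bool)) : ℝ :=
  ∫ ω, ∫ d, FDP (fun i => (ω i).1) d ∂(κ fun i => (ω i).2) ∂(M.jointN n)

/-- The false non-discovery rate `FNR = E[FNP]` of a (randomized) decision rule. -/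
noncomputable def FNR (n : ℕ) (κ : (Fin n → 𝒳) → Measure (Fin n → Bool)) : ℝ :=
  ∫ ω, ∫ d, FNP (fun i => (ω i).1) d ∂(κ fun i => (ω i).2) ∂(M.jointN n)

/-- The marginal FDR `mFDR = E[Σ δi (1-θi)] / E[Σ δi]` (with `0/0 = 0`). -/
noncomputable def mFDR (n : ℕ) (κ : (Fin n → 𝒳) → Measure (Fin n → Bool)) : ℝ :=
  (∫ ω, ∫ d, nFD (fun i => (ω i).1) d ∂(κ fun i => (ω i).2) ∂(M.jointN n)) /
    (∫ ω, ∫ d, nRej d ∂(κ fun i => (ω i).2) ∂(M.jointN n))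

/-- The marginal FNR `mFNR = E[Σ (1-δi) θi] / E[Σ (1-δi)]` (with `0/0 = 0`). -/
noncomputable def mFNR (n : ℕ) (κ : (Fin n → 𝒳) → Measure (Fin n → Bool)) : ℝ :=
  (∫ ω, ∫ d, nFN (fun i => (ω i).1) d ∂(κ fun i => (ω i).2) ∂(M.jointN n)) /
    (∫ ω, ∫ d, nAcc d ∂(κ fun i => (ω i).2) ∂(M.jointN n))

/-- `FNR*_n(α)`: the minimum FNR over decision rules controlling FDR at level `α`. -/
noncomputable def FNRstar (n : ℕ) (α : ℝ) : ℝ :=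
  sInf {r | ∃ κ : (Fin n → 𝒳) → Measure (Fin n → Bool),
    IsRule κ ∧ M.FDR n κ ≤ α ∧ r = M.FNR n κ}

/-- The minimum mFNR over decision rules for `n` hypotheses controlling mFDR at level `α`. -/
noncomputable def mFNRstarN (n : ℕ) (α : ℝ) : ℝ :=
  sInf {r | ∃ κ : (Fin n → 𝒳) → Measure (Fin n → Bool),
    IsRule κ ∧ M.mFDR n κ ≤ α ∧ r = M.mFNR n κ}

/-- `mFNR*(α)` (this quantity does not depend on the number of hypotheses; we take `n = 1`). -/
noncomputable def mFNRstar (α : ℝ) : ℝ := M.mFNRstarN 1 α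

/-- The marginal law of a single observation `X ∼ f`. -/
noncomputable def Pmix : Measure 𝒳 := M.base.withDensity fun x => ENNReal.ofReal (M.f x)

/-- The law of `W = Lfdr(X)`, `X ∼ f`. -/
noncomputable def νW : Measure ℝ := M.Pmix.map M.Lfdr

/-- `G(t) = P(W ≤ t)`. -/
noncomputable def G (t : ℝ) : ℝ := (M.νW (Set.Iic t)).toReal

/-- `Ḡ(t) = P(W < t)`. -/
noncomputable def Gbar (t : ℝ) : ℝ := (M.νW (Set.Iio t)).toReal

/-- The generalized inverse `G^{-1}(u) = inf{t : G(t) ≥ u}`. -/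
noncomputable def Ginv (u : ℝ) : ℝ := sInf {t | u ≤ M.G t}

/-- `P(W = t)`. -/
noncomputable def atom (t : ℝ) : ℝ := (M.νW {t}).toReal

/-- The randomization probability `p(u)`, satisfying
`Ḡ(G^{-1}(u)) + p(u) P(W = G^{-1}(u)) = u`. -/
noncomputable def pu (u : ℝ) : ℝ := (u - M.Gbar (M.Ginv u)) / M.atom (M.Ginv u)

/-- `a(u) = E[W | S_u = 1]` for `u ∈ (0,1]`, `a(0) = 0`, where `S_u` is the Bernoulli(u)
thresholding variable of `W` at `G^{-1}(u)` with randomization `p(u)` at the boundary. -/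
noncomputable def a (u : ℝ) : ℝ :=
  if u = 0 then 0
  else ((∫ w in Set.Iio (M.Ginv u), w ∂M.νW) + M.pu u * (M.Ginv u * M.atom (M.Ginv u))) / u

/-- `b(u) = E[1 - W | S_u = 0]` for `u ∈ [0,1)`, `b(1) = 0`. -/
noncomputable def b (u : ℝ) : ℝ :=
  if u = 1 then 0
  else ((∫ w in Set.Ioi (M.Ginv u), (1 - w) ∂M.νW)
      + (1 - M.pu u) * ((1 - M.Ginv u) * M.atom (M.Ginv u))) / (1 - u)

/-- `b*(α) = inf{b(u) : u ∈ [0,1], a(u) ≤ α}`. -/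
noncomputable def bstar (α : ℝ) : ℝ :=
  sInf {y | ∃ u ∈ Set.Icc (0 : ℝ) 1, M.a u ≤ α ∧ y = M.b u}

/-- `u*(α) = sup{u ∈ [0,1] : a(u) ≤ α}`. -/
noncomputable def ustar (α : ℝ) : ℝ :=
  sSup {u | u ∈ Set.Icc (0 : ℝ) 1 ∧ M.a u ≤ α}

/-- `b**(α) = inf{E[b(U)] : U a [0,1]-valued random variable with E[a(U)] ≤ α}`. -/
noncomputable def bstarstar (α : ℝ) : ℝ :=
  sInf {y | ∃ ρ : Measure ℝ, IsProbabilityMeasure ρ ∧ (∀ᵐ u ∂ρ, u ∈ Set.Icc (0 : ℝ) 1) ∧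
    (∫ u, M.a u ∂ρ) ≤ α ∧ y = ∫ u, M.b u ∂ρ}

end Model

/-- The Bernoulli(p) measure on `Bool`. -/
noncomputable def bern (p : ℝ) : Measure Bool :=
  (ENNReal.ofReal p) • Measure.dirac true + (ENNReal.ofReal (1 - p)) • Measure.dirac false

namespace Model

variable {𝒳 : Type*} [MeasurableSpace 𝒳] (M : Model 𝒳)

/-- The per-observation rejection probability of the Neyman–Pearson rule at level `α`:
reject if `Lfdr(x) < G^{-1}(u*(α))`, randomize with probability `p(u*(α))` at equality,
and accept otherwise. -/
noncomputable def qNP (α : ℝ) (x : 𝒳) : ℝ :=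
  if M.Lfdr x < M.Ginv (M.ustar α) then 1
  else if M.Lfdr x = M.Ginv (M.ustar α) then M.pu (M.ustar α)
  else 0

/-- The Neyman–Pearson rule `δ^n_NP(α)`, as a Markov kernel: independent randomized
likelihood-ratio tests applied to each observation. -/
noncomputable def NP (α : ℝ) (n : ℕ) : (Fin n → 𝒳) → Measure (Fin n → Bool) :=
  fun x => Measure.pi fun i => bern (M.qNP α (x i))

/-- The probability (over data and the randomization of the rule `κ`) that the decision vector
lies in the set `E θ` (which may depend on the true labels `θ`). -/
noncomputable def prob (n : ℕ) (κ : (Fin n → 𝒳) → Measure (Fin n → Bool))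
    (E : (Fin n → Bool) → Set (Fin n → Bool)) : ℝ :=
  (∫⁻ ω, κ (fun i => (ω i).2) (E fun i => (ω i).1) ∂(M.jointN n)).toReal

end Model

/-- `sortedVal n w i` is the `i`-th order statistic `w_(i)` (for `1 ≤ i ≤ n`) of
`w 0, …, w (n-1)`. -/
noncomputable def sortedVal (n : ℕ) (w : Fin n → ℝ) (i : ℕ) : ℝ :=
  ((Multiset.map w Finset.univ.val).sort (· ≤ ·)).getD (i - 1) 0

/-- `avgLow n w k = (1/k) Σ_{i=1}^k w_(i)` (equal to `0` when `k = 0`). -/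
noncomputable def avgLow (n : ℕ) (w : Fin n → ℝ) (k : ℕ) : ℝ :=
  (∑ i ∈ Finset.Icc 1 k, sortedVal n w i) / k

/-- `avgHigh n w k = (1/(n-k)) Σ_{i=k+1}^n (1 - w_(i))` (equal to `0` when `k = n`). -/
noncomputable def avgHigh (n : ℕ) (w : Fin n → ℝ) (k : ℕ) : ℝ :=
  (∑ i ∈ Finset.Icc (k + 1) n, (1 - sortedVal n w i)) / ((n : ℝ) - k)

/-- The greatest convex minorant on `[0,1]` of a function `h`, evaluated at `α`. -/
noncomputable def gcm (h : ℝ → ℝ) (α : ℝ) : ℝ :=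
  sSup {y | ∃ C : ℝ → ℝ, ConvexOn ℝ (Set.Icc 0 1) C ∧
    (∀ t ∈ Set.Icc (0 : ℝ) 1, C t ≤ h t) ∧ y = C α}

end TwoGroup

namespace TwoGroup

section OrderStatistics

variable {ι : Type*} {I J : Finset ι} {v : ι → ℝ} {t : ℝ}

lemma card_mul_sub_sum_posPart_le (hJ : J ⊆ I) (t : ℝ) :
    J.card * t - ∑ i ∈ I, max (t - v i) 0 ≤ ∑ i ∈ J, v i := by
  have h1 : ∑ i ∈ J, max (t - v i) 0 ≤ ∑ i ∈ I, max (t - v i) 0 :=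
    Finset.sum_le_sum_of_subset_of_nonneg hJ fun _ _ _ => le_max_right _ _
  have h2 : ∑ i ∈ J, (t - v i) ≤ ∑ i ∈ J, max (t - v i) 0 :=
    Finset.sum_le_sum fun _ _ => le_max_left _ _
  rw [Finset.sum_sub_distrib, Finset.sum_const, nsmul_eq_mul] at h2
  linarith

lemma sum_eq_card_mul_sub_sum_posPart (hJ : J ⊆ I) (hle : ∀ i ∈ J, v i ≤ t)
    (hge : ∀ i ∈ I, i ∉ J → t ≤ v i) :
    ∑ i ∈ J, v i = J.card * t - ∑ i ∈ I, max (t - v i) 0 := by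
  have h1 : ∑ i ∈ J, max (t - v i) 0 = ∑ i ∈ I, max (t - v i) 0 :=
    Finset.sum_subset hJ fun i hi hi' => max_eq_right (by linarith [hge i hi hi'])
  have h2 : ∑ i ∈ J, max (t - v i) 0 = ∑ i ∈ J, (t - v i) :=
    Finset.sum_congr rfl fun i hi => max_eq_left (by linarith [hle i hi])
  rw [← h1, h2, Finset.sum_sub_distrib, Finset.sum_const, nsmul_eq_mul]
  ring

lemma sortedVal_eq_getElem {n : ℕ} {w : Fin n → ℝ} {i : ℕ}
    (hi : i < ((Multiset.map w Finset.univ.val).sort (· ≤ ·)).length) :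
    sortedVal n w (i + 1) = ((Multiset.map w Finset.univ.val).sort (· ≤ ·))[i] := by
  rw [sortedVal, Nat.add_sub_cancel, List.getD_eq_getElem _ _ hi]

lemma length_sort_map_univ {n : ℕ} (w : Fin n → ℝ) :
    ((Multiset.map w Finset.univ.val).sort (· ≤ ·)).length = n := by
  simp

lemma sortedVal_mono {n : ℕ} (w : Fin n → ℝ) {i j : ℕ} (hij : i ≤ j) (hj : j < n) :
    sortedVal n w (i + 1) ≤ sortedVal n w (j + 1) := by
  have hl := length_sort_map_univ w
  rw [sortedVal_eq_getElem (by omega), sortedVal_eq_getElem (by omega)]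
  exact (Multiset.pairwise_sort _ _).sortedLE.getElem_le_getElem_of_le hij

lemma sortedVal_mem {n : ℕ} {w : Fin n → ℝ} {s : Set ℝ} (hw : ∀ i, w i ∈ s) {i : ℕ}
    (hi : i < n) : sortedVal n w (i + 1) ∈ s := by
  have hl := length_sort_map_univ w
  rw [sortedVal_eq_getElem (by omega)]
  have := List.getElem_mem (l := (Multiset.map w Finset.univ.val).sort (· ≤ ·)) (n := i)
    (by omega)
  rw [Multiset.mem_sort, Multiset.mem_map] at this
  obtain ⟨j, -, hj⟩ := this
  exact hj ▸ hw j

lemma sum_range_sortedVal {n : ℕ} (w : Fin n → ℝ) (φ : ℝ → ℝ) :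
    ∑ i ∈ Finset.range n, φ (sortedVal n w (i + 1)) = ∑ j, φ (w j) := by
  have hl := length_sort_map_univ w
  have h1 : ∑ j, φ (w j) = (((Multiset.map w Finset.univ.val).sort (· ≤ ·)).map φ).sum := by
    rw [← Multiset.sum_coe, ← Multiset.map_coe, Multiset.sort_eq, Multiset.map_map]
    rfl
  rw [h1, ← Fin.sum_univ_fun_getElem, Finset.sum_range]
  refine Fintype.sum_equiv (finCongr hl.symm) _ _ fun i => ?_
  rw [sortedVal_eq_getElem (by omega)]
  rfl

end OrderStatistics

namespace Model

variable {𝒳 : Type*} [MeasurableSpace 𝒳] (M : Model 𝒳)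

lemma π1_pos : 0 < M.π1 := sub_pos.2 M.π0_mem.2

lemma Lfdr_mem (x : 𝒳) : M.Lfdr x ∈ Set.Icc (0 : ℝ) 1 := by
  have h0 := mul_nonneg M.π0_mem.1.le (M.f0_nonneg x)
  have h1 := mul_nonneg M.π1_pos.le (M.f1_nonneg x)
  unfold Lfdr f
  exact ⟨by positivity, div_le_one_of_le₀ (by linarith) (by positivity)⟩

lemma measurable_f : Measurable M.f :=
  (M.f0_meas.const_mul _).add (M.f1_meas.const_mul _)

lemma measurable_Lfdr : Measurable M.Lfdr :=
  (M.f0_meas.const_mul _).div M.measurable_f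

instance isProbabilityMeasure_joint : IsProbabilityMeasure M.joint := by
  have := M.f0_prob
  have := M.f1_prob
  constructor
  simp only [joint, Measure.coe_add, Measure.coe_smul, Pi.add_apply, Pi.smul_apply, measure_univ,
    smul_eq_mul, mul_one]
  rw [← ENNReal.ofReal_add M.π0_mem.1.le M.π1_pos.le, π1]
  simp

lemma map_snd_joint : M.joint.map Prod.snd = M.Pmix := by
  have := M.f0_prob
  have := M.f1_prob
  have h0 := M.π0_mem.1.le
  have h1 := M.π1_pos.le
  rw [joint, Measure.map_add _ _ measurable_snd, Measure.map_smul, Measure.map_smul,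
    ← Measure.snd, ← Measure.snd, Measure.snd_prod, Measure.snd_prod, Pmix,
    ← withDensity_smul _ M.f0_meas.ennreal_ofReal, ← withDensity_smul _ M.f1_meas.ennreal_ofReal,
    ← withDensity_add_left (M.f0_meas.ennreal_ofReal.const_smul _)]
  congr 1
  funext x
  simp only [Pi.add_apply, Pi.smul_apply, smul_eq_mul, f]
  rw [ENNReal.ofReal_add (mul_nonneg h0 (M.f0_nonneg x)) (mul_nonneg h1 (M.f1_nonneg x)),
    ENNReal.ofReal_mul h0, ENNReal.ofReal_mul h1]

lemma νW_eq_map_joint : M.νW = M.joint.map fun p => M.Lfdr p.2 := by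
  rw [νW, ← map_snd_joint, Measure.map_map M.measurable_Lfdr measurable_snd]
  rfl

lemma measurable_Lfdr_snd : Measurable fun p : Bool × 𝒳 => M.Lfdr p.2 :=
  M.measurable_Lfdr.comp measurable_snd

instance isProbabilityMeasure_νW : IsProbabilityMeasure M.νW := by
  rw [νW_eq_map_joint]
  exact Measure.isProbabilityMeasure_map M.measurable_Lfdr_snd.aemeasurable

instance isProbabilityMeasure_jointN (n : ℕ) : IsProbabilityMeasure (M.jointN n) := by
  unfold jointN
  infer_instance

lemma ae_νW_mem : ∀ᵐ w ∂M.νW, w ∈ Set.Icc (0 : ℝ) 1 := by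
  rw [νW_eq_map_joint]
  exact (ae_map_iff (p := fun w => w ∈ Set.Icc (0 : ℝ) 1) M.measurable_Lfdr_snd.aemeasurable
    measurableSet_Icc).2 (ae_of_all _ fun p => M.Lfdr_mem p.2)

/-- Hoeffding's inequality for a bounded function of the local fdr values. -/
lemma hoeffding_upper {n : ℕ} {h : ℝ → ℝ} (hm : Measurable h)
    (hb : ∀ w ∈ Set.Icc (0 : ℝ) 1, h w ∈ Set.Icc (0 : ℝ) 1) {δ : ℝ} (hδ : 0 ≤ δ) :
    (M.jointN n).real {ω | δ ≤ ∑ i, h (M.Lfdr (ω i).2) - n * ∫ w, h w ∂M.νW} ≤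
      Real.exp (-(2 * δ ^ 2 / n)) := by
  have hmeas : Measurable fun p : Bool × 𝒳 => h (M.Lfdr p.2) := hm.comp M.measurable_Lfdr_snd
  have hint : ∫ w, h w ∂M.νW = ∫ p, h (M.Lfdr p.2) ∂M.joint := by
    rw [νW_eq_map_joint, integral_map M.measurable_Lfdr_snd.aemeasurable
      hm.aestronglyMeasurable]
  have hsub := hasSubgaussianMGF_of_mem_Icc (μ := M.joint) hmeas.aemeasurable
    (ae_of_all _ fun p => hb _ (M.Lfdr_mem p.2))
  have hind : iIndepFun (fun (i : Fin n) (ω : Fin n → Bool × 𝒳) =>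
      h (M.Lfdr (ω i).2) - ∫ w, h w ∂M.νW) (M.jointN n) :=
    iIndepFun_pi (X := fun _ (p : Bool × 𝒳) => h (M.Lfdr p.2) - ∫ w, h w ∂M.νW)
      fun _ => (hmeas.sub_const _).aemeasurable
  have key := HasSubgaussianMGF.measure_sum_ge_le_of_iIndepFun hind (s := Finset.univ)
    (c := fun _ => (‖(1 : ℝ) - 0‖₊ / 2) ^ 2) (fun i _ => by
      have hmp := measurePreserving_eval (fun _ : Fin n => M.joint) i
      rw [← hint, ← hmp.map_eq] at hsub
      exact hsub.of_map hmp.measurable.aemeasurable) hδ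
  simp only [Finset.sum_sub_distrib, Finset.sum_const, Finset.card_univ, Fintype.card_fin,
    nsmul_eq_mul] at key
  refine key.trans_eq ?_
  congr 1
  push_cast
  rcases Nat.eq_zero_or_pos n with rfl | hn
  · simp
  · norm_num
    field_simp
    norm_num

lemma integrable_of_mem_Icc {h : ℝ → ℝ} (hm : Measurable h)
    (hb : ∀ w ∈ Set.Icc (0 : ℝ) 1, h w ∈ Set.Icc (0 : ℝ) 1) : Integrable h M.νW :=
  Integrable.of_mem_Icc 0 1 hm.aemeasurable (M.ae_νW_mem.mono hb)

/-- Concentration of a statistic `T` whose dual representation is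
`T = max_t (m t - ∑ (t - g(W_i))⁺)`, attained at some `t ∈ [0,1]`, around `m` times its
population version, where `s` is the optimal randomized selection function. -/
lemma concentration_of_dual {n m : ℕ} {τ : ℝ} (hτ : 0 < τ) (hn : 0 < n) (hm : τ ≤ (m : ℝ) / n)
    {g s : ℝ → ℝ} (hgm : Measurable g) (hsm : Measurable s)
    (hg : ∀ w ∈ Set.Icc (0 : ℝ) 1, g w ∈ Set.Icc (0 : ℝ) 1)
    (hs : ∀ w, s w ∈ Set.Icc (0 : ℝ) 1)
    (hs_int : ∫ w, s w ∂M.νW = (m : ℝ) / n)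
    {c : ℝ} (hc : c ∈ Set.Icc (0 : ℝ) 1) (hcs : ∀ w, max (c - g w) 0 = s w * (c - g w))
    {T : (Fin n → Bool × 𝒳) → ℝ}
    (hT : ∀ ω t, m * t - ∑ i, max (t - g (M.Lfdr (ω i).2)) 0 ≤ T ω)
    (hT' : ∀ ω, ∃ t ∈ Set.Icc (0 : ℝ) 1,
      T ω = m * t - ∑ i, max (t - g (M.Lfdr (ω i).2)) 0)
    {ε : ℝ} (hε : 0 < ε) :
    ((M.jointN n) {ω | ε < |T ω / m - (∫ w, s w * g w ∂M.νW) / ((m : ℝ) / n)|}).toReal ≤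
      6 * Real.exp (-(n * τ ^ 2 * ε ^ 2) / 2) := by
  have hn' : (0 : ℝ) < n := by exact_mod_cast hn
  have hm' : τ * n ≤ m := (le_div_iff₀ hn').1 hm
  have hmpos : (0 : ℝ) < m := lt_of_lt_of_le (by positivity) hm'
  have hmn : (n : ℝ) * ((m : ℝ) / n) = m := by field_simp
  have hb2 : ∀ w ∈ Set.Icc (0 : ℝ) 1, s w * g w ∈ Set.Icc (0 : ℝ) 1 := fun w hw =>
    ⟨mul_nonneg (hs w).1 (hg w hw).1, mul_le_one₀ (hs w).2 (hg w hw).1 (hg w hw).2⟩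
  have hb3 : ∀ w ∈ Set.Icc (0 : ℝ) 1, 1 - s w * (1 - g w) ∈ Set.Icc (0 : ℝ) 1 := fun w hw => by
    have h1 := mul_nonneg (hs w).1 (sub_nonneg.2 (hg w hw).2)
    have h2 : s w * (1 - g w) ≤ 1 :=
      mul_le_one₀ (hs w).2 (sub_nonneg.2 (hg w hw).2) (by linarith [(hg w hw).1])
    exact ⟨by linarith, by linarith⟩
  have hb1 : ∀ w ∈ Set.Icc (0 : ℝ) 1, max (c - g w) 0 ∈ Set.Icc (0 : ℝ) 1 := fun w hw =>
    ⟨le_max_right _ _, max_le (by linarith [hc.2, (hg w hw).1]) zero_le_one⟩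
  have hm2 : Measurable fun w => s w * g w := hsm.mul hgm
  have hm3 : Measurable fun w => 1 - s w * (1 - g w) :=
    (hsm.mul (hgm.const_sub _)).const_sub _
  have hm1 : Measurable fun w => max (c - g w) 0 := (hgm.const_sub _).max measurable_const
  have i2 := M.integrable_of_mem_Icc hm2 hb2
  have is := M.integrable_of_mem_Icc hsm fun w _ => hs w
  set A := ∫ w, s w * g w ∂M.νW with hA
  have e1 : ∫ w, max (c - g w) 0 ∂M.νW = c * ((m : ℝ) / n) - A := by
    rw [← hs_int, hA, ← integral_const_mul, ← integral_sub (is.const_mul c) i2]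
    congr 1; funext w; rw [hcs]; ring
  have e3 : ∫ w, (1 - s w * (1 - g w)) ∂M.νW = 1 - (m : ℝ) / n + A := by
    have : (fun w => 1 - s w * (1 - g w)) = fun w => (1 - s w) + s w * g w := by
      funext w; ring
    have i1 : Integrable (fun w => 1 - s w) M.νW := (integrable_const 1).sub is
    rw [this, integral_add i1 i2, integral_sub (integrable_const 1) is,
      hs_int]
    simp [hA]
  have hδ : 0 ≤ m * ε := by positivity
  have p1 := M.hoeffding_upper (n := n) hm1 hb1 hδ
  have p2 := M.hoeffding_upper (n := n) hm2 hb2 hδ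
  have p3 := M.hoeffding_upper (n := n) hm3 hb3 hδ
  rw [e1] at p1
  rw [e3] at p3
  have hexp : Real.exp (-(2 * (m * ε) ^ 2 / n)) ≤ Real.exp (-(n * τ ^ 2 * ε ^ 2) / 2) := by
    refine Real.exp_le_exp.2 ?_
    have h1 : n * τ ^ 2 * ε ^ 2 ≤ (m * ε) ^ 2 / n := by
      rw [le_div_iff₀ hn']
      calc n * τ ^ 2 * ε ^ 2 * n = (τ * n) ^ 2 * ε ^ 2 := by ring
        _ ≤ (m : ℝ) ^ 2 * ε ^ 2 := by gcongr
        _ = (m * ε) ^ 2 := by ring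
    have h2 : 0 ≤ n * τ ^ 2 * ε ^ 2 := by positivity
    rw [mul_div_assoc]
    linarith
  set E1 := {ω : Fin n → Bool × 𝒳 | m * ε ≤ ∑ i, max (c - g (M.Lfdr (ω i).2)) 0
    - n * (c * ((m : ℝ) / n) - A)} with hE1
  set E2 := {ω : Fin n → Bool × 𝒳 | m * ε ≤ ∑ i, s (M.Lfdr (ω i).2) * g (M.Lfdr (ω i).2)
    - n * A} with hE2
  set E3 := {ω : Fin n → Bool × 𝒳 | m * ε ≤
    ∑ i, (1 - s (M.Lfdr (ω i).2) * (1 - g (M.Lfdr (ω i).2)))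
    - n * (1 - (m : ℝ) / n + A)} with hE3
  have hsubset : {ω | ε < |T ω / m - A / ((m : ℝ) / n)|} ⊆ E1 ∪ E2 ∪ E3 := by
    intro ω hω
    have hω : ε < |T ω / m - A / ((m : ℝ) / n)| := hω
    have hrew : T ω / m - A / ((m : ℝ) / n) = (T ω - n * A) / m := by field_simp
    rw [hrew, lt_abs, ← neg_div, lt_div_iff₀ hmpos, lt_div_iff₀ hmpos] at hω
    rcases hω with hup | hlow
    · obtain ⟨t, ht, hTt⟩ := hT' ω
      have hle : ∑ i, s (M.Lfdr (ω i).2) * (t - g (M.Lfdr (ω i).2)) ≤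
          ∑ i, max (t - g (M.Lfdr (ω i).2)) 0 := by
        refine Finset.sum_le_sum fun i _ => ?_
        have h1 := hs (M.Lfdr (ω i).2)
        rcases le_total 0 (t - g (M.Lfdr (ω i).2)) with h | h
        · exact (mul_le_of_le_one_left h h1.2).trans (le_max_left _ _)
        · exact (mul_nonpos_of_nonneg_of_nonpos h1.1 h).trans (le_max_right _ _)
      have hs1 : ∑ i, s (M.Lfdr (ω i).2) * (t - g (M.Lfdr (ω i).2)) =
          t * ∑ i, s (M.Lfdr (ω i).2) - ∑ i, s (M.Lfdr (ω i).2) * g (M.Lfdr (ω i).2) := by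
        rw [Finset.mul_sum, ← Finset.sum_sub_distrib]
        exact Finset.sum_congr rfl fun i _ => by ring
      have hs2 : ∑ i, (1 - s (M.Lfdr (ω i).2) * (1 - g (M.Lfdr (ω i).2))) =
          n - ∑ i, s (M.Lfdr (ω i).2) + ∑ i, s (M.Lfdr (ω i).2) * g (M.Lfdr (ω i).2) := by
        have : (n : ℝ) = ∑ i : Fin n, (1 : ℝ) := by simp
        rw [this, ← Finset.sum_sub_distrib, ← Finset.sum_add_distrib]
        exact Finset.sum_congr rfl fun i _ => by ring
      rcases le_total ((m : ℝ) - ∑ i, s (M.Lfdr (ω i).2)) 0 with h | h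
      · refine Or.inl (Or.inr ?_)
        simp only [hE2, Set.mem_ofPred_eq]
        nlinarith [mul_nonpos_of_nonneg_of_nonpos ht.1 h]
      · refine Or.inr ?_
        simp only [hE3, Set.mem_ofPred_eq]
        rw [hs2, mul_add, mul_sub, hmn]
        nlinarith [mul_le_of_le_one_left h ht.2]
    · refine Or.inl (Or.inl ?_)
      simp only [hE1, Set.mem_ofPred_eq]
      have := hT ω c
      have h4 : (n : ℝ) * (c * ((m : ℝ) / n) - A) = m * c - n * A := by
        rw [mul_sub, mul_left_comm, hmn]; ring
      rw [h4]
      linarith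
  change (M.jointN n).real _ ≤ _
  calc (M.jointN n).real {ω | ε < |T ω / m - A / ((m : ℝ) / n)|}
      ≤ (M.jointN n).real (E1 ∪ E2 ∪ E3) := measureReal_mono hsubset
    _ ≤ (M.jointN n).real E1 + (M.jointN n).real E2 + (M.jointN n).real E3 :=
        (measureReal_union_le _ _).trans (by gcongr; exact measureReal_union_le _ _)
    _ ≤ 6 * Real.exp (-(n * τ ^ 2 * ε ^ 2) / 2) := by
        linarith [Real.exp_pos (-(n * τ ^ 2 * ε ^ 2) / 2)]

lemma G_eq_cdf (t : ℝ) : M.G t = cdf M.νW t := (cdf_eq_real _ _).symm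

lemma G_one : M.G 1 = 1 := by
  have : ∀ᵐ w ∂M.νW, w ∈ Set.Iic (1 : ℝ) := M.ae_νW_mem.mono fun w hw => hw.2
  rw [G, (mem_ae_iff_prob_eq_one measurableSet_Iic).1 this, ENNReal.toReal_one]

lemma Gbar_eq_zero {t : ℝ} (ht : t ≤ 0) : M.Gbar t = 0 := by
  have : M.νW (Set.Iio t) = 0 :=
    measure_eq_zero_iff_ae_notMem.2 (M.ae_νW_mem.mono fun w hw h => by
      linarith [hw.1, Set.mem_Iio.1 h])
  simp [Gbar, this]

lemma G_eq_zero {t : ℝ} (ht : t < 0) : M.G t = 0 := by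
  have : M.νW (Set.Iic t) = 0 :=
    measure_eq_zero_iff_ae_notMem.2 (M.ae_νW_mem.mono fun w hw h => by
      linarith [hw.1, Set.mem_Iic.1 h])
  simp [G, this]

lemma G_eq_Gbar_add_atom (t : ℝ) : M.G t = M.Gbar t + M.atom t := by
  have h : Set.Iic t = Set.Iio t ∪ {t} := by simp
  have hu : M.νW.real (Set.Iio t ∪ {t}) = M.νW.real (Set.Iio t) + M.νW.real {t} :=
    measureReal_union (by simp) (measurableSet_singleton t)
  rw [← h] at hu
  exact hu

lemma Ginv_zero : M.Ginv 0 = 0 := by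
  have : {t | 0 ≤ M.G t} = Set.univ := Set.eq_univ_of_forall fun t => ENNReal.toReal_nonneg
  rw [Ginv, this, Real.sInf_univ]

lemma bddBelow_superlevel {u : ℝ} (hu : 0 < u) : 0 ∈ lowerBounds {t | u ≤ M.G t} := by
  intro t ht
  by_contra! h
  have : u ≤ M.G t := ht
  rw [M.G_eq_zero h] at this
  linarith

lemma Ginv_mem {u : ℝ} (hu : u ∈ Set.Icc (0 : ℝ) 1) : M.Ginv u ∈ Set.Icc (0 : ℝ) 1 := by
  rcases hu.1.eq_or_lt with rfl | h
  · simp [Ginv_zero]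
  · have h1 : (1 : ℝ) ∈ {t | u ≤ M.G t} := by simpa [G_one] using hu.2
    exact ⟨le_csInf ⟨1, h1⟩ (M.bddBelow_superlevel h), csInf_le ⟨0, M.bddBelow_superlevel h⟩ h1⟩

lemma le_G_Ginv {u : ℝ} (hu : u ∈ Set.Icc (0 : ℝ) 1) : u ≤ M.G (M.Ginv u) := by
  rcases hu.1.eq_or_lt with rfl | h
  · exact ENNReal.toReal_nonneg
  · have h1 : (1 : ℝ) ∈ {t | u ≤ M.G t} := by simpa [G_one] using hu.2
    have hcont := (cdf M.νW).right_continuous (M.Ginv u)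
    have htend : Tendsto (cdf M.νW) (nhdsWithin (M.Ginv u) (Set.Ioi (M.Ginv u)))
        (nhds (cdf M.νW (M.Ginv u))) := hcont.mono Set.Ioi_subset_Ici_self
    rw [G_eq_cdf]
    refine ge_of_tendsto htend (eventually_nhdsWithin_of_forall fun t ht => ?_)
    obtain ⟨r, hr, hrt⟩ := exists_lt_of_csInf_lt ⟨1, h1⟩ (Set.mem_Ioi.1 ht)
    have hr : u ≤ M.G r := hr
    rw [G_eq_cdf] at hr
    exact hr.trans ((cdf M.νW).mono hrt.le)

lemma Gbar_Ginv_le {u : ℝ} (hu : u ∈ Set.Icc (0 : ℝ) 1) : M.Gbar (M.Ginv u) ≤ u := by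
  rcases hu.1.eq_or_lt with rfl | h
  · rw [Ginv_zero, M.Gbar_eq_zero le_rfl]
  · have hGbar : M.Gbar (M.Ginv u) = Function.leftLim (cdf M.νW) (M.Ginv u) := by
      have h2 := StieltjesFunction.measure_Iio (cdf M.νW) (tendsto_cdf_atBot M.νW) (M.Ginv u)
      rw [measure_cdf, sub_zero] at h2
      rw [Gbar, h2, ENNReal.toReal_ofReal]
      exact (cdf_nonneg M.νW (M.Ginv u - 1)).trans
        ((cdf M.νW).mono.le_leftLim (by linarith))
    rw [hGbar]
    refine le_of_tendsto ((cdf M.νW).mono.tendsto_leftLim _)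
      (eventually_nhdsWithin_of_forall fun t ht => ?_)
    by_contra! hlt
    rw [← G_eq_cdf] at hlt
    exact absurd (csInf_le ⟨0, M.bddBelow_superlevel h⟩ hlt.le) (not_le.2 ht)

lemma pu_mul_atom {u : ℝ} (hu : u ∈ Set.Icc (0 : ℝ) 1) :
    M.pu u * M.atom (M.Ginv u) = u - M.Gbar (M.Ginv u) := by
  rcases eq_or_ne (M.atom (M.Ginv u)) 0 with h | h
  · have h1 := M.le_G_Ginv hu
    have h2 := M.Gbar_Ginv_le hu
    rw [G_eq_Gbar_add_atom, h] at h1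
    rw [h]
    linarith
  · exact div_mul_cancel₀ _ h

lemma pu_mem {u : ℝ} (hu : u ∈ Set.Icc (0 : ℝ) 1) : M.pu u ∈ Set.Icc (0 : ℝ) 1 := by
  have h1 := M.le_G_Ginv hu
  have h2 := M.Gbar_Ginv_le hu
  rw [G_eq_Gbar_add_atom] at h1
  have h3 : 0 ≤ M.atom (M.Ginv u) := ENNReal.toReal_nonneg
  exact ⟨div_nonneg (by linarith) h3, div_le_one_of_le₀ (by linarith) h3⟩

/-- Selection function: select on `A`, and with probability `p` at the boundary point `t`. -/
noncomputable def select (A : Set ℝ) (t p w : ℝ) : ℝ :=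
  A.indicator 1 w + ({t} : Set ℝ).indicator (fun _ => p) w

lemma measurable_select {A : Set ℝ} (hA : MeasurableSet A) (t p : ℝ) :
    Measurable (select A t p) :=
  (measurable_one.indicator hA).add (measurable_const.indicator (measurableSet_singleton t))

lemma select_mem {A : Set ℝ} {t p : ℝ} (hA : t ∉ A) (hp : p ∈ Set.Icc (0 : ℝ) 1) (w : ℝ) :
    select A t p w ∈ Set.Icc (0 : ℝ) 1 := by
  unfold select
  by_cases h1 : w = t
  · subst h1
    simpa [hA] using hp
  · by_cases h2 : w ∈ A <;> simp [h1, h2]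

lemma integral_select_mul {A : Set ℝ} (hA : MeasurableSet A) (t p : ℝ) {h : ℝ → ℝ}
    (hi : Integrable h M.νW) :
    ∫ w, select A t p w * h w ∂M.νW = (∫ w in A, h w ∂M.νW) + p * (h t * M.atom t) := by
  have e : (fun w => select A t p w * h w) =
      fun w => A.indicator h w + ({t} : Set ℝ).indicator (fun w => p * h w) w := by
    funext w
    by_cases h2 : w = t
    · subst h2
      by_cases h1 : w ∈ A <;> simp [select, h1, add_mul]
    · by_cases h1 : w ∈ A <;> simp [select, h1, h2]
  rw [e, integral_add (hi.indicator hA) ((hi.const_mul p).indicator (measurableSet_singleton t)),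
    integral_indicator hA, integral_indicator (measurableSet_singleton t), integral_singleton]
  simp only [smul_eq_mul, atom, Measure.real]
  ring

lemma integral_select {A : Set ℝ} (hA : MeasurableSet A) (t p : ℝ) :
    ∫ w, select A t p w ∂M.νW = M.νW.real A + p * M.atom t := by
  simpa using M.integral_select_mul hA t p (integrable_const (1 : ℝ))

end Model

/-- **Concentration of partial averages of ordered Lfdr values** (Lemma 4). For `τ ∈ (0,1)`
and `n ≥ 1/τ`: (a) if `τ ≤ k/n ≤ 1` then `(1/k) Σ_{i=1}^k W_(i)` concentrates around
`a(k/n)`; (b) if `0 ≤ k/n ≤ 1-τ` then `(1/(n-k)) Σ_{i=k+1}^n (1-W_(i))` concentrates around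
`b(k/n)`; both with probability bound `6 exp(-nτ²ε²/2)`. -/
theorem ordered_avg_concentration {𝒳 : Type*} [MeasurableSpace 𝒳] (M : Model 𝒳)
    (τ : ℝ) (hτ : τ ∈ Set.Ioo (0 : ℝ) 1) (n : ℕ) (hn : 1 / τ ≤ (n : ℝ)) :
    (∀ k : ℕ, τ ≤ (k : ℝ) / n → k ≤ n → ∀ ε > (0 : ℝ),
      ((M.jointN n)
          {ω | ε < |avgLow n (fun j => M.Lfdr (ω j).2) k - M.a ((k : ℝ) / n)|}).toReal ≤
        6 * Real.exp (-(n * τ ^ 2 * ε ^ 2) / 2)) ∧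
    (∀ k : ℕ, (k : ℝ) / n ≤ 1 - τ → ∀ ε > (0 : ℝ),
      ((M.jointN n)
          {ω | ε < |avgHigh n (fun j => M.Lfdr (ω j).2) k - M.b ((k : ℝ) / n)|}).toReal ≤
        6 * Real.exp (-(n * τ ^ 2 * ε ^ 2) / 2)) := by
  have hτ0 := hτ.1
  have hn' : (0 : ℝ) < n := lt_of_lt_of_le (by positivity) hn
  have hn0 : 0 < n := by exact_mod_cast hn'
  refine ⟨fun k hk hkn ε hε => ?_, fun k hk ε hε => ?_⟩
  · have hu0 : 0 < (k : ℝ) / n := hτ0.trans_le hk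
    have hk0 : 0 < k := by
      rcases Nat.eq_zero_or_pos k with rfl | h
      · simp at hu0
      · exact h
    have hu : (k : ℝ) / n ∈ Set.Icc (0 : ℝ) 1 :=
      ⟨hu0.le, div_le_one_of_le₀ (by exact_mod_cast hkn) hn'.le⟩
    set u := (k : ℝ) / n with hu_def
    have ha : M.a u = (∫ w, Model.select (Set.Iio (M.Ginv u)) (M.Ginv u) (M.pu u) w * w ∂M.νW)
        / u := by
      rw [M.integral_select_mul measurableSet_Iio _ _
        (h := fun w => w)
        (M.integrable_of_mem_Icc measurable_id fun w hw => hw), Model.a, if_neg hu0.ne']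
    simp only [ha, avgLow]
    refine M.concentration_of_dual (g := fun w => w) hτ0 hn0 hk measurable_id
      (Model.measurable_select measurableSet_Iio _ _) (fun w hw => hw)
      (Model.select_mem (by simp) (M.pu_mem hu)) ?_ (M.Ginv_mem hu) ?_ ?_ ?_ hε
    · rw [M.integral_select measurableSet_Iio, M.pu_mul_atom hu]
      simp [Model.Gbar, Measure.real, hu_def]
    · intro w
      rcases lt_trichotomy w (M.Ginv u) with h | h | h
      · simp [Model.select, h, h.ne, h.le]
      · simp [h]
      · simp [Model.select, h.ne', h.le]
    all_goals
      intro ω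
      have hsum : ∑ i ∈ Finset.Icc 1 k, sortedVal n (fun j => M.Lfdr (ω j).2) i =
          ∑ i ∈ Finset.range k, sortedVal n (fun j => M.Lfdr (ω j).2) (i + 1) := by
        rw [Finset.range_eq_Ico, Finset.sum_Ico_add'
          (fun i => sortedVal n (fun j => M.Lfdr (ω j).2) i)]
        rfl
      have hsub : Finset.range k ⊆ Finset.range n := Finset.range_subset_range.2 hkn
      rw [hsum]
    · intro t
      have := card_mul_sub_sum_posPart_le
        (v := fun i => sortedVal n (fun j => M.Lfdr (ω j).2) (i + 1)) hsub t
      rwa [Finset.card_range, sum_range_sortedVal _ fun w => max (t - w) 0] at this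
    · set t := sortedVal n (fun j => M.Lfdr (ω j).2) (k - 1 + 1) with ht
      refine ⟨t, sortedVal_mem (fun j => M.Lfdr_mem _) (by omega), ?_⟩
      rw [sum_eq_card_mul_sub_sum_posPart (t := t) hsub, Finset.card_range,
        sum_range_sortedVal _ fun w => max (t - w) 0]
      · intro i hi
        rw [Finset.mem_range] at hi
        exact sortedVal_mono _ (by omega) (by omega)
      · intro i hi hi'
        rw [Finset.mem_range] at hi hi'
        exact sortedVal_mono _ (by omega) hi
  · have hu1 : (k : ℝ) / n < 1 := by linarith
    have hkn : k < n := by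
      rw [div_lt_one hn'] at hu1
      exact_mod_cast hu1
    have hu : (k : ℝ) / n ∈ Set.Icc (0 : ℝ) 1 := ⟨by positivity, hu1.le⟩
    have hmn : ((n - k : ℕ) : ℝ) = n - k := Nat.cast_sub hkn.le
    have hmu : ((n - k : ℕ) : ℝ) / n = 1 - (k : ℝ) / n := by
      rw [hmn, sub_div, div_self hn'.ne']
    have hgm : Measurable fun w : ℝ => 1 - w := measurable_id.const_sub _
    have hg : ∀ w ∈ Set.Icc (0 : ℝ) 1, 1 - w ∈ Set.Icc (0 : ℝ) 1 := fun w hw =>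
      ⟨by linarith [hw.2], by linarith [hw.1]⟩
    have hb : M.b ((k : ℝ) / n) = (∫ w, Model.select (Set.Ioi (M.Ginv ((k : ℝ) / n)))
        (M.Ginv ((k : ℝ) / n)) (1 - M.pu ((k : ℝ) / n)) w * (1 - w) ∂M.νW)
        / (((n - k : ℕ) : ℝ) / n) := by
      rw [M.integral_select_mul measurableSet_Ioi _ _ (M.integrable_of_mem_Icc hgm hg),
        Model.b, if_neg hu1.ne, hmu]
    simp only [hb, avgHigh, ← hmn]
    set u := (k : ℝ) / n with hu_def
    refine M.concentration_of_dual (g := fun w => 1 - w) hτ0 hn0 (by rw [hmu]; linarith) hgm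
      (Model.measurable_select measurableSet_Ioi _ _) hg
      (Model.select_mem (by simp) (hg _ (M.pu_mem hu))) ?_ (hg _ (M.Ginv_mem hu)) ?_ ?_ ?_ hε
    · rw [M.integral_select measurableSet_Ioi, one_sub_mul, M.pu_mul_atom hu, hmu,
        ← Set.compl_Iic, probReal_compl_eq_one_sub measurableSet_Iic]
      have : M.νW.real (Set.Iic (M.Ginv u)) = _ := M.G_eq_Gbar_add_atom (M.Ginv u)
      rw [this]
      ring
    · intro w
      rcases lt_trichotomy w (M.Ginv u) with h | h | h
      · simp [Model.select, h.ne, h.le]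
      · simp [h]
      · simp [Model.select, h, h.ne', h.le]
    all_goals
      intro ω
      have hsum : ∑ i ∈ Finset.Icc (k + 1) n, (1 - sortedVal n (fun j => M.Lfdr (ω j).2) i) =
          ∑ i ∈ Finset.Ico k n, (1 - sortedVal n (fun j => M.Lfdr (ω j).2) (i + 1)) := by
        rw [Finset.sum_Ico_add' (fun i => 1 - sortedVal n (fun j => M.Lfdr (ω j).2) i)]
        rfl
      have hsub : Finset.Ico k n ⊆ Finset.range n := fun i hi =>
        Finset.mem_range.2 (Finset.mem_Ico.1 hi).2
      rw [hsum]
    · intro t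
      have := card_mul_sub_sum_posPart_le
        (v := fun i => 1 - sortedVal n (fun j => M.Lfdr (ω j).2) (i + 1)) hsub t
      rwa [Nat.card_Ico, sum_range_sortedVal _ fun w => max (t - (1 - w)) 0] at this
    · set t := 1 - sortedVal n (fun j => M.Lfdr (ω j).2) (k + 1) with ht
      refine ⟨t, hg _ (sortedVal_mem (fun j => M.Lfdr_mem _) hkn), ?_⟩
      rw [sum_eq_card_mul_sub_sum_posPart (t := t) hsub, Nat.card_Ico,
        sum_range_sortedVal _ fun w => max (t - (1 - w)) 0]
      · intro i hi
        rw [Finset.mem_Ico] at hi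
        exact sub_le_sub_left (sortedVal_mono _ hi.1 hi.2) _
      · intro i hi hi'
        rw [Finset.mem_Ico] at hi'
        rw [Finset.mem_range] at hi
        exact sub_le_sub_left (sortedVal_mono _ (by omega) hkn) _

end TwoGroup
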